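/- arXiv:2603.13407 — 3 statements merged into one kernel-verified Lean document; each statement's English description precedes it below -/
import Mathlib

section
/- Let S ~ Binomial(m, p) with p ∈ (0,1) and let q ∈ [0,1]. Let X := S + B_q and Y := S + B_p, where B_q ~ Bernoulli(q) and B_p ~ Bernoulli(p) are independent of S. Then TV(law(X), law(Y)) = |q − p| · max_k P(S = k). Consequently, as m → ∞, TV(law(X), law(Y)) = |q − p| / √(2π m p(1−p)) + O(m^{−1}). -/
open MeasureTheory

/-- Total variation distance between two measures:
`TV(μ,ν) = sup_{A measurable} |μ(A) − ν(A)|`. -/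
noncomputable def tvDist {X : Type*} [MeasurableSpace X] (μ ν : Measure X) : ℝ :=
  ⨆ A : {A : Set X // MeasurableSet A}, |(μ A.1).toReal - (ν A.1).toReal|

/-- The binomial law `Bin(m,p)` as a measure on `ℤ`. -/
noncomputable def binomMeasure (m : ℕ) (p : ℝ) : Measure ℤ :=
  ∑ k ∈ Finset.range (m + 1),
    (ENNReal.ofReal ((m.choose k : ℝ) * p ^ k * (1 - p) ^ (m - k))) •
      Measure.dirac (k : ℤ)

/-- The Bernoulli law `Ber(q)` as a measure on `ℤ`. -/
noncomputable def bernMeasure (q : ℝ) : Measure ℤ :=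
  (ENNReal.ofReal (1 - q)) • Measure.dirac (0 : ℤ) +
    (ENNReal.ofReal q) • Measure.dirac (1 : ℤ)

/-- The law of `S + B` where `S ~ Bin(m,p)` and `B ~ Ber(q)` are independent. -/
noncomputable def binPlusBer (m : ℕ) (p q : ℝ) : Measure ℤ :=
  Measure.map (fun z : ℤ × ℤ => z.1 + z.2) ((binomMeasure m p).prod (bernMeasure q))

/-- binomial weights -/
noncomputable def bw (m : ℕ) (p : ℝ) (k : ℕ) : ℝ := (m.choose k : ℝ) * p ^ k * (1 - p) ^ (m - k)

lemma bw_nonneg (m : ℕ) (p : ℝ) (hp0 : 0 < p) (hp1 : p < 1) (k : ℕ) : 0 ≤ bw m p k := by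
  have : 0 < 1 - p := by linarith
  unfold bw; positivity

lemma bw_rec (m : ℕ) (p : ℝ) (k : ℕ) (hk : k ≤ m) :
    ((k : ℝ) + 1) * (1 - p) * bw m p (k + 1) = ((m : ℝ) - k) * p * bw m p k := by
  unfold bw
  have h := Nat.choose_succ_right_eq m k
  have h2 : (m.choose (k+1) : ℝ) * ((k : ℝ) + 1) = m.choose k * ((m : ℝ) - k) := by
    rw [← Nat.cast_sub hk]; exact_mod_cast h
  rcases hk.eq_or_lt with rfl | hlt
  · simp
  · obtain ⟨d, rfl⟩ : ∃ d, m = k + 1 + d := ⟨m - (k+1), by omega⟩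
    have e1 : k + 1 + d - (k + 1) = d := by omega
    have e2 : k + 1 + d - k = d + 1 := by omega
    rw [e1, e2, pow_succ, pow_succ]
    linear_combination p^k * p * (1-p)^d * (1-p) * h2

lemma bw_mono (m : ℕ) (p : ℝ) (hp0 : 0 < p) (hp1 : p < 1) (k : ℕ)
    (hk : k < ⌊((m : ℝ) + 1) * p⌋₊) : bw m p k ≤ bw m p (k + 1) := by
  have hk' : ((k + 1 : ℕ) : ℝ) ≤ ((m : ℝ) + 1) * p := (Nat.le_floor_iff (by positivity)).1 hk
  push_cast at hk'
  have hkm : k ≤ m := by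
    have : (k : ℝ) + 1 ≤ m + 1 := hk'.trans (by nlinarith [(Nat.cast_nonneg m : (0:ℝ) ≤ m)])
    exact_mod_cast (by linarith : (k : ℝ) ≤ m)
  have h := bw_rec m p k hkm
  have h0 := bw_nonneg m p hp0 hp1 k
  have hpos : 0 < ((k : ℝ) + 1) * (1 - p) := mul_pos (by positivity) (by linarith)
  refine le_of_mul_le_mul_left ?_ hpos
  rw [h]
  exact mul_le_mul_of_nonneg_right (by nlinarith) h0

lemma bw_anti (m : ℕ) (p : ℝ) (hp0 : 0 < p) (hp1 : p < 1) (k : ℕ)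
    (hk : ⌊((m : ℝ) + 1) * p⌋₊ ≤ k) : bw m p (k + 1) ≤ bw m p k := by
  rcases le_or_gt k m with hkm | hkm
  · have hk' : ((m : ℝ) + 1) * p < k + 1 := by
      have := Nat.lt_of_floor_lt (Nat.lt_succ_of_le hk)
      push_cast at this; exact this
    have h := bw_rec m p k hkm
    have h0 := bw_nonneg m p hp0 hp1 k
    have hpos : 0 < ((k : ℝ) + 1) * (1 - p) := mul_pos (by positivity) (by linarith)
    refine le_of_mul_le_mul_left ?_ hpos
    rw [h]
    exact mul_le_mul_of_nonneg_right (by nlinarith) h0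
  · have : bw m p (k+1) = 0 := by unfold bw; rw [Nat.choose_eq_zero_of_lt (by omega)]; simp
    rw [this]; exact bw_nonneg m p hp0 hp1 k

lemma bw_le_mode (m : ℕ) (p : ℝ) (hp0 : 0 < p) (hp1 : p < 1) (k : ℕ) :
    bw m p k ≤ bw m p ⌊((m : ℝ) + 1) * p⌋₊ := by
  rcases le_total k ⌊((m : ℝ) + 1) * p⌋₊ with h | h
  · exact Nat.decreasingInduction' (P := fun j => bw m p j ≤ bw m p ⌊((m : ℝ) + 1) * p⌋₊)
      (fun j hj _ ih => (bw_mono m p hp0 hp1 j hj).trans ih) h le_rfl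
  · induction k, h using Nat.le_induction with
    | base => exact le_rfl
    | succ j hj ih => exact (bw_anti m p hp0 hp1 j hj).trans ih

lemma mode_le (m : ℕ) (p : ℝ) (hp0 : 0 < p) (hp1 : p < 1) : ⌊((m : ℝ) + 1) * p⌋₊ ≤ m := by
  have : ⌊((m : ℝ) + 1) * p⌋₊ < m + 1 := by
    rw [Nat.floor_lt (by positivity)]; push_cast; nlinarith [(Nat.cast_nonneg m : (0:ℝ) ≤ m)]
  omega

lemma abel_bound (b a : ℕ → ℝ) (K m : ℕ) (hK : K ≤ m) (hb : ∀ k, 0 ≤ b k) 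
    (h1 : ∀ k < K, b k ≤ b (k+1)) (h2 : ∀ k, K ≤ k → b (k+1) ≤ b k)
    (ha0 : ∀ k, 0 ≤ a k) (ha1 : ∀ k, a k ≤ 1) :
    |∑ k ∈ Finset.range (m+1), b k * (a (k+1) - a k)| ≤ b K := by
  have A : ∀ n ≤ K, b n * (a n - 1) ≤ ∑ k ∈ Finset.range n, b k * (a (k+1) - a k) ∧
      ∑ k ∈ Finset.range n, b k * (a (k+1) - a k) ≤ b n * a n := by
    intro n
    induction n with
    | zero => intro _; simp only [Finset.range_zero, Finset.sum_empty]
              constructor <;> nlinarith [hb 0, ha0 0, ha1 0]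
    | succ n ih =>
      intro hn
      obtain ⟨i1, i2⟩ := ih (by omega)
      have := h1 n (by omega)
      rw [Finset.sum_range_succ]
      constructor <;> nlinarith [ha0 (n+1), ha1 (n+1)]
  have B : ∀ n, K ≤ n → ∑ k ∈ Finset.range n, b k * (a (k+1) - a k) + b n * (1 - a n) ≤ b K ∧
      -b K ≤ ∑ k ∈ Finset.range n, b k * (a (k+1) - a k) - b n * a n := by
    intro n hn
    induction n, hn using Nat.le_induction with
    | base => obtain ⟨i1, i2⟩ := A K le_rfl
              constructor <;> linarith
    | succ n hn ih =>
      obtain ⟨i1, i2⟩ := ih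
      have := h2 n hn
      rw [Finset.sum_range_succ]
      constructor <;> nlinarith [ha0 (n+1), ha1 (n+1)]
  obtain ⟨i1, i2⟩ := B (m+1) (by omega)
  rw [abs_le]
  constructor <;> nlinarith [ha0 (m+1), ha1 (m+1), hb (m+1)]

lemma binPlusBer_apply (m : ℕ) (p q : ℝ) (hp0 : 0 < p) (hp1 : p < 1) (hq0 : 0 ≤ q) (hq1 : q ≤ 1)
    (A : Set ℤ) : ((binPlusBer m p q) A).toReal =
      ∑ k ∈ Finset.range (m+1), bw m p k *
        ((1 - q) * A.indicator 1 (k : ℤ) + q * A.indicator 1 ((k : ℤ) + 1)) := by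
  have : SFinite (bernMeasure q) := by unfold bernMeasure; infer_instance
  unfold binPlusBer
  rw [Measure.map_apply (measurable_of_countable _) (MeasurableSet.of_discrete),
    Measure.prod_apply (MeasurableSet.of_discrete)]
  unfold binomMeasure
  rw [lintegral_finsetSum_measure, ENNReal.toReal_sum]
  · refine Finset.sum_congr rfl fun k _ => ?_
    rw [lintegral_smul_measure, lintegral_dirac, smul_eq_mul, ENNReal.toReal_mul,
      ENNReal.toReal_ofReal (by simpa only [bw] using bw_nonneg m p hp0 hp1 k)]
    unfold bw
    congr 1
    unfold bernMeasure
    simp only [Measure.add_apply, Measure.smul_apply, smul_eq_mul]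
    rw [Measure.dirac_apply, Measure.dirac_apply]
    have e0 : (0:ℤ) ∈ Prod.mk (k:ℤ) ⁻¹' ((fun z : ℤ × ℤ => z.1 + z.2) ⁻¹' A) ↔ (k:ℤ) ∈ A := by simp
    have e1 : (1:ℤ) ∈ Prod.mk (k:ℤ) ⁻¹' ((fun z : ℤ × ℤ => z.1 + z.2) ⁻¹' A) ↔ (k:ℤ) + 1 ∈ A := by
      simp
    have f1 : 0 ≤ 1 - q := by linarith
    by_cases h0 : (k:ℤ) ∈ A <;> by_cases h1 : (k:ℤ) + 1 ∈ A <;>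
      simp [Set.indicator, h0, h1, ENNReal.toReal_add, hq0, f1]
  · intro k _
    rw [lintegral_smul_measure, lintegral_dirac, smul_eq_mul]
    refine ENNReal.mul_ne_top ENNReal.ofReal_ne_top ?_
    have : IsFiniteMeasure (bernMeasure q) := by
      constructor
      unfold bernMeasure
      simp
    exact measure_ne_top _ _

lemma binom_singleton (m : ℕ) (p : ℝ) (hp0 : 0 < p) (hp1 : p < 1) (k : ℕ) :
    (binomMeasure m p {(k:ℤ)}).toReal = bw m p k := by
  unfold binomMeasure
  rw [Measure.finsetSum_apply, ENNReal.toReal_sum]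
  · have : ∀ j ∈ Finset.range (m+1), ((ENNReal.ofReal ((m.choose j : ℝ) * p ^ j * (1 - p) ^ (m - j)) •
      Measure.dirac (j : ℤ)) {(k:ℤ)}).toReal = if j = k then bw m p k else 0 := by
      intro j _
      have := bw_nonneg m p hp0 hp1 j
      unfold bw at this
      by_cases h : j = k
      · subst h; simp [bw, this]
      · simp [h]
    rw [Finset.sum_congr rfl this, Finset.sum_ite_eq']
    split_ifs with h
    · rfl
    · unfold bw; rw [Nat.choose_eq_zero_of_lt (by simpa using h)]; simp
  · intro j _
    rw [Measure.smul_apply, smul_eq_mul]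
    exact ENNReal.mul_ne_top ENNReal.ofReal_ne_top (measure_ne_top _ _)

lemma binom_sup (m : ℕ) (p : ℝ) (hp0 : 0 < p) (hp1 : p < 1) :
    ⨆ k : ℤ, ((binomMeasure m p) {k}).toReal = bw m p ⌊((m : ℝ) + 1) * p⌋₊ := by
  have ub : ∀ k : ℤ, ((binomMeasure m p) {k}).toReal ≤ bw m p ⌊((m : ℝ) + 1) * p⌋₊ := by
    intro k
    rcases le_or_gt 0 k with h | h
    · obtain ⟨n, rfl⟩ := Int.eq_ofNat_of_zero_le h
      rw [binom_singleton m p hp0 hp1]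
      exact bw_le_mode m p hp0 hp1 n
    · have : (binomMeasure m p) {k} = 0 := by
        unfold binomMeasure
        rw [Measure.finsetSum_apply]
        refine Finset.sum_eq_zero fun j _ => ?_
        have : (j : ℤ) ≠ k := by omega
        simp [this]
      rw [this]; simpa using bw_nonneg m p hp0 hp1 _
  apply le_antisymm (ciSup_le ub)
  rw [← binom_singleton m p hp0 hp1]
  exact le_ciSup (f := fun k : ℤ => ((binomMeasure m p) {k}).toReal) 
    ⟨_, by rintro _ ⟨k, rfl⟩; exact ub k⟩ _

lemma tv_eq (p q : ℝ) (hp0 : 0 < p) (hp1 : p < 1) (hq0 : 0 ≤ q) (hq1 : q ≤ 1) (m : ℕ) :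
    tvDist (binPlusBer m p q) (binPlusBer m p p) =
        |q - p| * bw m p ⌊((m : ℝ) + 1) * p⌋₊ := by
  set K := ⌊((m : ℝ) + 1) * p⌋₊ with hKdef
  have hK : K ≤ m := mode_le m p hp0 hp1
  have diff : ∀ A : Set ℤ, |((binPlusBer m p q) A).toReal - ((binPlusBer m p p) A).toReal| =
      |q - p| * |∑ k ∈ Finset.range (m+1), bw m p k *
        ((A.indicator 1 (((k+1 : ℕ) : ℤ)) : ℝ) - A.indicator 1 ((k : ℕ) : ℤ))| := by
    intro A
    rw [binPlusBer_apply m p q hp0 hp1 hq0 hq1, binPlusBer_apply m p p hp0 hp1 hp0.le hp1.le,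
      ← Finset.sum_sub_distrib, ← abs_mul, Finset.mul_sum]
    congr 1
    refine Finset.sum_congr rfl fun k _ => ?_
    push_cast
    ring
  have ub : ∀ A : {A : Set ℤ // MeasurableSet A},
      |((binPlusBer m p q) A.1).toReal - ((binPlusBer m p p) A.1).toReal| ≤ |q - p| * bw m p K := by
    intro A
    rw [diff]
    refine mul_le_mul_of_nonneg_left ?_ (abs_nonneg _)
    refine abel_bound (bw m p) (fun k => (A.1).indicator 1 (k : ℤ)) K m hK (bw_nonneg m p hp0 hp1)
      (bw_mono m p hp0 hp1) (bw_anti m p hp0 hp1) (fun k => ?_) (fun k => ?_)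
    · exact Set.indicator_nonneg (fun _ _ => by simp) _
    · exact Set.indicator_le_self' (fun _ _ => by simp) _
  unfold tvDist
  apply le_antisymm (ciSup_le ub)
  have hA := le_ciSup (f := fun A : {A : Set ℤ // MeasurableSet A} =>
    |((binPlusBer m p q) A.1).toReal - ((binPlusBer m p p) A.1).toReal|) 
    ⟨_, by rintro _ ⟨k, rfl⟩; exact ub k⟩ ⟨Set.Ioi (K : ℤ), MeasurableSet.of_discrete⟩
  refine le_trans (le_of_eq ?_) hA
  simp only
  rw [diff]
  congr 1
  have : ∀ k ∈ Finset.range (m+1), bw m p k *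
        (((Set.Ioi (K:ℤ)).indicator 1 (((k+1 : ℕ) : ℤ)) : ℝ) - (Set.Ioi (K:ℤ)).indicator 1 ((k : ℕ) : ℤ))
      = if k = K then bw m p K else 0 := by
    intro k _
    simp only [Set.indicator, Set.mem_Ioi, Nat.cast_lt, Pi.one_apply]
    rcases lt_trichotomy k K with h | h | h
    · rw [if_neg (by omega), if_neg (by omega), if_neg (by omega)]; simp
    · subst h; simp
    · rw [if_pos (by omega), if_pos (by omega), if_neg (by omega)]; simp
  rw [Finset.sum_congr rfl this, Finset.sum_ite_eq', if_pos (by simp; omega),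
    abs_of_nonneg (bw_nonneg m p hp0 hp1 K)]

lemma stirling_upper (n : ℕ) (hn : 1 ≤ n) :
    Real.log (Stirling.stirlingSeq n) ≤ Real.log (√Real.pi) + 1 / (12 * n) := by
  have hd : ∀ j, Real.log (Stirling.stirlingSeq n) - 1 / (12 * n) ≤
      Real.log (Stirling.stirlingSeq (n + j)) - 1 / (12 * ((n + j : ℕ) : ℝ)) := by
    intro j
    induction j with
    | zero => simp
    | succ j ih =>
      refine ih.trans ?_
      have h := Stirling.log_stirlingSeq_sdiff_le (n + j)
      have hpos : (0:ℝ) < ((n + j : ℕ) : ℝ) := by exact_mod_cast (by omega : 0 < n + j)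
      have : (1:ℝ) / (12 * ((n + j : ℕ) : ℝ) * (((n + j : ℕ) : ℝ) + 1)) =
        1 / (12 * ((n + j : ℕ) : ℝ)) - 1 / (12 * ((n + (j+1) : ℕ) : ℝ)) := by
        rw [← add_assoc, Nat.cast_add_one (n + j)]
        field_simp
        ring
      rw [this] at h
      rw [← add_assoc] at h ⊢
      linarith
  have hlim : Filter.Tendsto (fun j : ℕ => Real.log (Stirling.stirlingSeq (n + j)) )
      Filter.atTop (nhds (Real.log (√Real.pi))) := by
    have h1 : Filter.Tendsto (fun j : ℕ => Stirling.stirlingSeq (n + j)) Filter.atTop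
        (nhds (√Real.pi)) := by
      simpa [add_comm] using (Filter.tendsto_add_atTop_iff_nat n).2 Stirling.tendsto_stirlingSeq_sqrt_pi
    exact h1.log (by positivity)
  have := ge_of_tendsto' hlim (fun j => (hd j).trans (sub_le_self _ (by positivity)))
  linarith

lemma log_fact (n : ℕ) (hn : 1 ≤ n) : ∃ e : ℝ, 0 ≤ e ∧ e ≤ 1 / (12 * n) ∧
    Real.log (n.factorial) = e + Real.log (2 * Real.pi) / 2 + Real.log n / 2 + n * Real.log n - n := by
  have hn' : (0:ℝ) < n := by exact_mod_cast hn
  refine ⟨Real.log (Stirling.stirlingSeq n) - Real.log (√Real.pi), ?_, ?_, ?_⟩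
  · have := Real.log_le_log (by positivity) (Stirling.sqrt_pi_le_stirlingSeq (n := n) (by omega))
    linarith
  · have := stirling_upper n hn
    linarith
  · rw [Stirling.log_stirlingSeq_formula, Real.log_sqrt (by positivity),
      Real.log_mul (by norm_num) (by positivity), Real.log_mul (by norm_num) (by positivity),
      Real.log_div (by positivity) (by positivity), Real.log_exp]
    ring

/-- log bounds -/
lemma log_bd (y : ℝ) (k s : ℝ) (hs : 0 < s) (hk : 0 < k) (hy : y = k / s) :
    (k - s) / k ≤ Real.log y ∧ Real.log y ≤ (k - s) / s ∧
    k - s ≤ k * Real.log y ∧ k * Real.log y ≤ (k - s) + (k - s)^2 / s := by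
  have hy0 : 0 < y := by rw [hy]; positivity
  have h1 := Real.one_sub_inv_le_log_of_pos hy0
  have h2 := Real.log_le_sub_one_of_pos hy0
  have e1 : 1 - y⁻¹ = (k - s)/k := by rw [hy]; field_simp
  have e2 : y - 1 = (k - s)/s := by rw [hy]; field_simp
  rw [e1] at h1; rw [e2] at h2
  refine ⟨h1, h2, ?_, ?_⟩
  · have := mul_le_mul_of_nonneg_left h1 hk.le
    rwa [mul_div_cancel₀ _ hk.ne'] at this
  · have := mul_le_mul_of_nonneg_left h2 hk.le
    refine this.trans (le_of_eq ?_)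
    field_simp; ring

set_option maxHeartbeats 1000000 in
lemma mode_log (p : ℝ) (hp0 : 0 < p) (hp1 : p < 1) (m K : ℕ) (hKm : K ≤ m)
    (hx : |(K : ℝ) - m * p| ≤ 1) (hm : 4 / (p * (1 - p)) ≤ m) :
    |Real.log (bw m p K) - Real.log (1 / √(2 * Real.pi * m * p * (1 - p)))|
      ≤ 4 / (p * (1 - p)) / m := by
  obtain ⟨L, rfl⟩ : ∃ L, m = K + L := ⟨m - K, by omega⟩
  set r := 1 - p with hr
  have hr0 : 0 < r := by linarith
  set M : ℝ := ((K + L : ℕ) : ℝ) with hM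
  have ha : 0 < p * r := by positivity
  have hap : p * r ≤ p := by nlinarith
  have har : p * r ≤ r := by nlinarith
  have hMa : 4 ≤ M * (p * r) := by rwa [div_le_iff₀ ha] at hm
  have hM0 : 0 < M := lt_of_lt_of_le (by positivity) hm
  obtain ⟨hx1, hx2⟩ := abs_le.1 hx
  have hL : (L : ℝ) = M - K := by rw [hM]; push_cast; ring
  have hMp : M * (p * r) ≤ M * p := by gcongr
  have hMr : M * (p * r) ≤ M * r := by gcongr
  have hLr : (L : ℝ) - M * r = -(K - M * p) := by rw [hL, hr]; ring
  have hK2 : M * (p * r) / 2 ≤ K := by linarith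
  have hL2 : M * (p * r) / 2 ≤ L := by linarith
  set T := M * (p * r) with hT
  have hT0 : 0 < T := by linarith
  have hK0 : (0:ℝ) < K := by linarith
  have hL0 : (0:ℝ) < L := by linarith
  obtain ⟨e1, p1, q1, f1⟩ := log_fact (K + L) (Nat.succ_le_of_lt (by rw [hM] at hM0; exact_mod_cast hM0))
  obtain ⟨e2, p2, q2, f2⟩ := log_fact K (by exact_mod_cast hK0)
  obtain ⟨e3, p3, q3, f3⟩ := log_fact L (by exact_mod_cast hL0)
  obtain ⟨a1, a2, a3, a4⟩ := log_bd _ K (M * p) (by positivity) hK0 rfl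
  obtain ⟨b1, b2, b3, b4⟩ := log_bd _ L (M * r) (by positivity) hL0 rfl
  rw [← hM] at f1 q1
  set x := (K:ℝ) - M * p with hxdef
  rw [hLr] at b1 b2 b3 b4
  have hlogb : Real.log (bw (K + L) p K) = Real.log ((K + L).factorial) - Real.log (K.factorial)
      - Real.log (L.factorial) + K * Real.log p + L * Real.log r := by
    have hc : ((K + L).choose K : ℝ) = (K + L).factorial / (K.factorial * L.factorial) := by
      rw [Nat.cast_add_choose]
    have : bw (K + L) p K = (K + L).factorial / (K.factorial * L.factorial) * p ^ K * r ^ L := by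
      unfold bw; rw [hc, Nat.add_sub_cancel_left]
    rw [this, Real.log_mul (by positivity) (by positivity), Real.log_mul (by positivity) (by positivity),
      Real.log_div (by positivity) (by positivity), Real.log_mul (by positivity) (by positivity),
      Real.log_pow, Real.log_pow]
    ring
  have htar : Real.log (1 / √(2 * Real.pi * M * p * r)) =
      - (Real.log (2 * Real.pi) + Real.log M + Real.log p + Real.log r) / 2 := by
    rw [one_div, Real.log_inv, Real.log_sqrt (by positivity), Real.log_mul (by positivity) (by positivity),
      Real.log_mul (by positivity) (by positivity), Real.log_mul (by positivity) (by positivity)]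
    ring
  have lK : Real.log (K / (M * p)) = Real.log K - Real.log M - Real.log p := by
    rw [Real.log_div (by positivity) (by positivity), Real.log_mul (by positivity) (by positivity)]; ring
  have lL : Real.log (L / (M * r)) = Real.log L - Real.log M - Real.log r := by
    rw [Real.log_div (by positivity) (by positivity), Real.log_mul (by positivity) (by positivity)]; ring
  have key : Real.log (bw (K + L) p K) - Real.log (1 / √(2 * Real.pi * M * p * r)) =
      e1 - e2 - e3 - Real.log (K / (M * p)) / 2 - Real.log (L / (M * r)) / 2
      - K * Real.log (K / (M * p)) - L * Real.log (L / (M * r)) := by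
    rw [hlogb, htar, lK, lL, f1, f2, f3, hL]
    ring
  have tgt : 4 / (p * r) / M = 4 * (1 / T) := by rw [hT]; field_simp
  rw [key, tgt]
  have hKi : 1 / (K:ℝ) ≤ 2 * (1 / T) := by
    rw [div_le_iff₀ hK0]; field_simp; linarith
  have hLi : 1 / (L:ℝ) ≤ 2 * (1 / T) := by
    rw [div_le_iff₀ hL0]; field_simp; linarith
  have hpi : 1 / (M * p) ≤ 1 / T := one_div_le_one_div_of_le hT0 hMp
  have hri : 1 / (M * r) ≤ 1 / T := one_div_le_one_div_of_le hT0 hMr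
  have hTM : T ≤ M := by
    have h1 : M * p ≤ M * 1 := mul_le_mul_of_nonneg_left hp1.le hM0.le
    rw [mul_one] at h1
    exact hMp.trans h1
  have hMi : 1 / M ≤ 1 / T := one_div_le_one_div_of_le hT0 hTM
  have g : ∀ y z s: ℝ, 0 < s → |z| ≤ 1 → 1 / s ≤ y → |z / s| ≤ y := by
    intro y z s hs hz hy
    rw [abs_div, abs_of_pos hs]
    exact (div_le_div_of_nonneg_right hz hs.le).trans hy
  have hxn : |-x| ≤ 1 := by rwa [abs_neg]
  have t1 := abs_le.1 (g _ x K hK0 hx hKi)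
  have t2 := abs_le.1 (g _ x (M*p) (by positivity) hx hpi)
  have t3 := abs_le.1 (g _ (-x) L hL0 hxn hLi)
  have t4 := abs_le.1 (g _ (-x) (M*r) (by positivity) hxn hri)
  have hsq : x^2 / (M * p) + (-x)^2/(M * r) ≤ 1 / T := by
    have : x^2 / (M * p) + (-x)^2/(M * r) = x^2 / T := by
      rw [hT]; field_simp; rw [hr]; ring
    rw [this]
    have : x^2 ≤ 1 := (sq_le_one_iff_abs_le_one x).2 hx
    gcongr
  have q1' : e1 ≤ 1 / T / 12 := by
    refine q1.trans ?_
    have : 1 / (12 * M) = 1 / M / 12 := by field_simp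
    linarith
  have q2' : e2 ≤ 1 / T / 6 := by
    refine q2.trans ?_
    have : 1 / (12 * (K:ℝ)) = 1 / K / 12 := by field_simp
    linarith
  have q3' : e3 ≤ 1 / T / 6 := by
    refine q3.trans ?_
    have : 1 / (12 * (L:ℝ)) = 1 / L / 12 := by field_simp
    linarith
  have hTi : 0 < 1 / T := by positivity
  rw [abs_le]
  constructor <;> linarith [t1.1, t1.2, t2.1, t2.2, t3.1, t3.2, t4.1, t4.2]

/-- Sharp binomial-plus-Bernoulli comparison (Theorem 7.1): with
`X = S + Ber(q)` and `Y = S + Ber(p)`, `S ~ Bin(m,p)` independent of the Bernoullis,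
`TV(law X, law Y) = |q − p|·max_k P(S = k)`; consequently, as `m → ∞`,
`TV(law X, law Y) = |q − p|/√(2πmp(1−p)) + O(m⁻¹)`. -/
theorem binomial_bernoulli_sharp_tv
    (p q : ℝ) (hp0 : 0 < p) (hp1 : p < 1) (hq0 : 0 ≤ q) (hq1 : q ≤ 1) :
    (∀ m : ℕ,
      tvDist (binPlusBer m p q) (binPlusBer m p p) =
        |q - p| * ⨆ k : ℤ, ((binomMeasure m p) {k}).toReal) ∧
    (∃ C : ℝ, ∃ M : ℕ, ∀ m : ℕ, M ≤ m →
      |tvDist (binPlusBer m p q) (binPlusBer m p p) -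
          |q - p| / Real.sqrt (2 * Real.pi * m * p * (1 - p))| ≤ C / m) := by
  have hr0 : 0 < 1 - p := by linarith
  refine ⟨fun m => by rw [tv_eq p q hp0 hp1 hq0 hq1, binom_sup m p hp0 hp1], ?_⟩
  refine ⟨|q - p| * (2 * (4 / (p * (1 - p)))), ⌈4 / (p * (1 - p))⌉₊, fun m hm => ?_⟩
  have hm' : 4 / (p * (1 - p)) ≤ m := Nat.ceil_le.1 hm
  have hm0 : (0:ℝ) < m := lt_of_lt_of_le (by positivity) hm'
  rw [tv_eq p q hp0 hp1 hq0 hq1]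
  have hK := mode_le m p hp0 hp1
  have hx : |((⌊((m : ℝ) + 1) * p⌋₊ : ℕ) : ℝ) - m * p| ≤ 1 := by
    have h1 := Nat.floor_le (by positivity : 0 ≤ ((m : ℝ) + 1) * p)
    have h2 := Nat.lt_floor_add_one (((m : ℝ) + 1) * p)
    rw [abs_le]; constructor <;> linarith
  have hlog := mode_log p hp0 hp1 m _ hK hx hm'
  set K := ⌊((m : ℝ) + 1) * p⌋₊
  set b := bw m p K with hb
  have hbpos : 0 < b := by
    have := Nat.choose_pos hK
    rw [hb]; unfold bw; positivity
  set S := √(2 * Real.pi * m * p * (1 - p)) with hS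
  have hSm : 1 ≤ S := by
    rw [hS, Real.one_le_sqrt]
    rw [div_le_iff₀ (by positivity)] at hm'
    nlinarith [Real.pi_gt_three]
  have hS0 : 0 < S := by linarith
  set D := Real.log b - Real.log (1 / S) with hD
  have hbe : b = 1 / S * Real.exp D := by
    rw [hD, Real.exp_sub, Real.exp_log hbpos, Real.exp_log (by positivity)]
    field_simp
  have hD1 : |D| ≤ 1 := hlog.trans (by rw [div_le_one hm0]; exact hm')
  have hE := Real.abs_exp_sub_one_le hD1
  have : |q - p| * b - |q - p| / S = |q - p| * (1 / S * (Real.exp D - 1)) := by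
    rw [hbe]; ring
  rw [this, abs_mul, abs_abs, mul_div_assoc]
  refine mul_le_mul_of_nonneg_left ?_ (abs_nonneg _)
  rw [abs_mul, abs_of_pos (by positivity : 0 < 1 / S)]
  have h1S : 1 / S ≤ 1 := by rw [div_le_one hS0]; exact hSm
  calc 1 / S * |Real.exp D - 1| ≤ 1 * (2 * |D|) := by gcongr
    _ ≤ _ := by rw [mul_div_assoc]; linarith
end

section
/- There exist constants c₀ > 0 and C < ∞ such that for every c ∈ (0, c₀] and every k ∈ ℤ, with λ := c^{−2} and z_{k,c} := c(k − λ): |P(Poisson(λ) = k) − ∫_{z_{k,c}−c/2}^{z_{k,c}+c/2} φ(x) dx| ≤ C·c²/(1 + |z_{k,c}|)³, where φ(x) = (2π)^{−1/2}e^{−x²/2} is the standard normal density and P(Poisson(λ) = k) := e^{−λ}λ^k/k! for k ≥ 0 and 0 for k < 0. -/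
open MeasureTheory intervalIntegral

/-- The standard normal density `φ(x) = (2π)^{-1/2} e^{-x²/2}`. -/
noncomputable def stdNormalDensity (x : ℝ) : ℝ :=
  Real.exp (-x ^ 2 / 2) / Real.sqrt (2 * Real.pi)

/-- The Poisson point mass `P(Poisson(λ) = k)` for `k : ℤ`, equal to
`e^{-λ}λ^k/k!` for `k ≥ 0` and `0` for `k < 0`. -/
noncomputable def poissonPoint (lam : ℝ) (k : ℤ) : ℝ :=
  if 0 ≤ k then Real.exp (-lam) * lam ^ k.toNat / (Nat.factorial k.toNat) else 0

lemma aux_stirling (k : ℕ) (hk : 1 ≤ k) :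
    0 ≤ Real.log (Stirling.stirlingSeq k) - Real.log (√Real.pi) ∧
    Real.log (Stirling.stirlingSeq k) - Real.log (√Real.pi) ≤ 1 / (12 * k) := by
  have hpi : 0 < √Real.pi := Real.sqrt_pos.2 Real.pi_pos
  constructor
  · have := Real.log_le_log hpi (Stirling.sqrt_pi_le_stirlingSeq (n := k) (by omega))
    linarith
  · obtain ⟨n, rfl⟩ : ∃ n, k = n + 1 := ⟨k - 1, by omega⟩
    have hmono : Monotone (fun m : ℕ => Real.log (Stirling.stirlingSeq (m + 1))
        - 1 / (12 * ((m : ℝ) + 1))) := by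
      apply monotone_nat_of_le_succ
      intro m
      have h := Stirling.log_stirlingSeq_sdiff_le (m + 1)
      have e : 1 / (12 * ((m : ℝ) + 1) * ((m : ℝ) + 2)) =
          1 / (12 * ((m : ℝ) + 1)) - 1 / (12 * ((m : ℝ) + 1 + 1)) := by
        field_simp
        ring
      push_cast at h ⊢
      have e3 : (m : ℝ) + 1 + 1 = m + 2 := by ring
      have : Real.log (Stirling.stirlingSeq (m + 1)) - Real.log (Stirling.stirlingSeq (m + 2)) ≤
        1 / (12 * ((m : ℝ) + 1) * ((m : ℝ) + 2)) := by
        rw [e3] at h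
        exact h
      rw [e] at this
      have e2 : m + 1 + 1 = m + 2 := rfl
      rw [e2]
      linarith
    have hlim : Filter.Tendsto (fun m : ℕ => Real.log (Stirling.stirlingSeq (m + 1))
        - 1 / (12 * ((m : ℝ) + 1))) Filter.atTop (nhds (Real.log (√Real.pi) - 0)) := by
      apply Filter.Tendsto.sub
      · exact ((Filter.tendsto_add_atTop_iff_nat 1).2 Stirling.tendsto_stirlingSeq_sqrt_pi).log hpi.ne'
      · have := (tendsto_one_div_add_atTop_nhds_zero_nat (𝕜 := ℝ)).const_mul (1/12)
        simp only [mul_zero] at this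
        refine this.congr fun m => ?_
        field_simp
    have := hmono.ge_of_tendsto hlim n
    push_cast
    linarith

lemma aux_h (u : ℝ) (hu : |u| ≤ 1 / 16) :
    |(1 + u) * Real.log (1 + u) - u - u ^ 2 / 2| ≤ 7 / 2 * |u| ^ 3 := by
  have h := Real.abs_log_sub_add_sum_range_le (x := -u) (by rw [abs_neg]; linarith) 2
  simp only [Finset.sum_range_succ, Finset.sum_range_zero, abs_neg, sub_neg_eq_add] at h
  norm_num at h
  set r := -u + u ^ 2 / 2 + Real.log (1 + u) with hr
  have e : (1 + u) * Real.log (1 + u) - u - u ^ 2 / 2 = -(u ^ 3 / 2) + (1 + u) * r := by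
    rw [hr]; ring
  have h3 : 0 ≤ |u| ^ 3 := by positivity
  have h2 : |r| ≤ 2 * |u| ^ 3 := by
    refine h.trans ?_
    rw [div_le_iff₀ (by linarith)]
    nlinarith
  rw [e]
  calc _ ≤ |-(u ^ 3 / 2)| + |(1 + u) * r| := abs_add_le _ _
    _ = |u| ^ 3 / 2 + |1 + u| * |r| := by rw [abs_neg, abs_div, abs_pow, abs_mul]; norm_num
    _ ≤ |u| ^ 3 / 2 + (1 + 1 / 16) * (2 * |u| ^ 3) := by
        gcongr
        exact (abs_add_le _ _).trans (by rw [abs_one]; linarith)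
    _ ≤ _ := by linarith

lemma aux_log (u : ℝ) (hu : |u| ≤ 1 / 16) : |Real.log (1 + u)| ≤ 2 * |u| := by
  have h := Real.abs_log_sub_add_sum_range_le (x := -u) (by rw [abs_neg]; linarith) 0
  simp only [Finset.sum_range_zero, abs_neg, sub_neg_eq_add] at h
  norm_num at h
  refine h.trans ?_
  rw [div_le_iff₀ (by linarith)]
  nlinarith [abs_nonneg u]

lemma aux_exp_one (a b M : ℝ) (hb : b ≤ M) : Real.exp b - Real.exp a ≤ |a - b| * Real.exp M := by
  have h1 : Real.exp a = Real.exp b * Real.exp (a - b) := by rw [← Real.exp_add]; ring_nf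
  have h2 := Real.add_one_le_exp (a - b)
  have h3 : Real.exp b ≤ Real.exp M := Real.exp_le_exp.2 hb
  have h4 := Real.exp_pos b
  have h5 := neg_abs_le (a - b)
  calc _ ≤ |a - b| * Real.exp b := by rw [h1]; nlinarith
    _ ≤ _ := by gcongr

lemma aux_exp (a b M : ℝ) (ha : a ≤ M) (hb : b ≤ M) :
    |Real.exp a - Real.exp b| ≤ |a - b| * Real.exp M := by
  rw [abs_le]
  have h1 := aux_exp_one a b M hb
  have h2 := aux_exp_one b a M ha
  rw [abs_sub_comm] at h2
  constructor <;> linarith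

lemma aux_decay (y : ℝ) (hy : 0 ≤ y) (n : ℕ) :
    (1 + y) ^ n * Real.exp (1 - y ^ 2 / 4) ≤ Real.exp 3 * n.factorial := by
  have h1 : Real.exp (1 - y ^ 2 / 4) ≤ Real.exp 3 * Real.exp (-(1 + y)) := by
    rw [← Real.exp_add]
    apply Real.exp_le_exp.2
    nlinarith [sq_nonneg (y / 2 - 1)]
  have h2 := Real.pow_div_factorial_le_exp (1 + y) (by linarith) n
  have hf : (0 : ℝ) < n.factorial := by positivity
  rw [div_le_iff₀ hf] at h2
  calc _ ≤ (Real.exp (1 + y) * n.factorial) * (Real.exp 3 * Real.exp (-(1 + y))) := by gcongr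
    _ = Real.exp 3 * n.factorial * (Real.exp (1 + y) * Real.exp (-(1 + y))) := by ring
    _ = _ := by rw [← Real.exp_add]; simp

lemma aux_sqrt : 1 ≤ √(2 * Real.pi) := by
  rw [Real.one_le_sqrt]; linarith [Real.pi_gt_three]

lemma aux_phi_sub (x z c : ℝ) (hc : 0 < c) (hc1 : c ≤ 1) (hx : |x - z| ≤ c / 2) :
    |stdNormalDensity x - stdNormalDensity z| ≤ c * (1 + |z|) * Real.exp (1 - |z| ^ 2 / 4) := by
  have hs := aux_sqrt
  unfold stdNormalDensity
  rw [← sub_div, abs_div, abs_of_pos (by linarith : 0 < √(2 * Real.pi))]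
  refine (div_le_self (abs_nonneg _) hs).trans ?_
  have hx2 : (x - z) ^ 2 ≤ 1 / 4 := by
    rw [← sq_abs]; nlinarith [abs_nonneg (x - z)]
  have := aux_exp (-x ^ 2 / 2) (-z ^ 2 / 2) (1 - |z| ^ 2 / 4)
    (by rw [sq_abs]; nlinarith [sq_nonneg (x + (x - z)), sq_nonneg (z - 2 * x)])
    (by rw [sq_abs]; nlinarith [sq_nonneg z])
  refine this.trans ?_
  gcongr
  have e : -x ^ 2 / 2 - -z ^ 2 / 2 = -((x - z) * ((x - z) + 2 * z) / 2) := by ring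
  rw [e, abs_neg, abs_div, abs_mul, abs_two]
  have h1 : |(x - z) + 2 * z| ≤ 1 / 2 + 2 * |z| := by
    refine (abs_add_le _ _).trans ?_
    rw [abs_mul, abs_two]; linarith
  calc _ ≤ c / 2 * (1 / 2 + 2 * |z|) / 2 := by gcongr
    _ ≤ _ := by nlinarith [abs_nonneg z]

lemma aux_cell (z c : ℝ) (hc : 0 < c) (hc1 : c ≤ 1) :
    |(∫ x in (z - c / 2)..(z + c / 2), stdNormalDensity x) - c * stdNormalDensity z| ≤
      c ^ 2 * (1 + |z|) * Real.exp (1 - |z| ^ 2 / 4) := by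
  have hcont : Continuous stdNormalDensity := by
    unfold stdNormalDensity; fun_prop
  have e : (∫ x in (z - c / 2)..(z + c / 2), stdNormalDensity x) - c * stdNormalDensity z =
      ∫ x in (z - c / 2)..(z + c / 2), (stdNormalDensity x - stdNormalDensity z) := by
    rw [intervalIntegral.integral_sub (hcont.intervalIntegrable _ _)
      (continuous_const.intervalIntegrable _ _), intervalIntegral.integral_const]
    simp only [smul_eq_mul]
    ring
  rw [e]
  have := intervalIntegral.norm_integral_le_of_norm_le_const (a := z - c / 2) (b := z + c / 2)
    (f := fun x => stdNormalDensity x - stdNormalDensity z)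
    (C := c * (1 + |z|) * Real.exp (1 - |z| ^ 2 / 4)) (by
      intro x hx
      rw [Set.uIoc_of_le (by linarith)] at hx
      apply aux_phi_sub x z c hc hc1
      rw [abs_le]; constructor <;> linarith [hx.1, hx.2])
  rw [Real.norm_eq_abs] at this
  refine this.trans (le_of_eq ?_)
  rw [show z + c / 2 - (z - c / 2) = c by ring, abs_of_pos hc]
  ring

/-- log-form of the Poisson mass -/
lemma aux_poisson (l u : ℝ) (k : ℕ) (hk : 1 ≤ k) (hl : 0 < l) (hku : (k : ℝ) = l * (1 + u)) :
    Real.exp (-l) * l ^ k / (k.factorial : ℝ) = √(1 / l) / √(2 * Real.pi) *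
      Real.exp (-(l * ((1 + u) * Real.log (1 + u) - u)) - 1 / 2 * Real.log (1 + u) -
        (Real.log (Stirling.stirlingSeq k) - Real.log (√Real.pi))) := by
  have hk0 : (0 : ℝ) < k := by exact_mod_cast hk
  have hu : 0 < 1 + u := by
    rw [hku] at hk0
    exact (pos_iff_pos_of_mul_pos hk0).1 hl
  have hf : (0 : ℝ) < k.factorial := by positivity
  have hpi := Real.pi_pos
  apply Real.log_injOn_pos
  · rw [Set.mem_Ioi]
    positivity
  · rw [Set.mem_Ioi]
    positivity
  have hst := Stirling.log_stirlingSeq_formula k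
  have hlk : Real.log k = Real.log l + Real.log (1 + u) := by
    rw [hku, Real.log_mul hl.ne' hu.ne']
  rw [Real.log_mul (by positivity) (by positivity), Real.log_div (by positivity) (by positivity),
    Real.log_div (by positivity) (by positivity), Real.log_mul (by positivity) (by positivity),
    Real.log_exp, Real.log_exp, Real.log_pow, Real.log_sqrt (by positivity),
    Real.log_sqrt (by positivity), Real.log_sqrt (by positivity),
    Real.log_mul (by positivity) (by positivity), one_div, Real.log_inv, hst,
    Real.log_div (by positivity) (by positivity), Real.log_exp,
    Real.log_mul (by positivity) (by positivity), hlk, hku]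
  ring

set_option maxHeartbeats 1600000 in
lemma aux_near (c z : ℝ) (k : ℕ) (hc : 0 < c) (hc1 : c ≤ 1) (hz : |c * z| ≤ 1 / 16)
    (hk : (k : ℝ) = (c ^ 2)⁻¹ * (1 + c * z)) :
    |Real.exp (-(c ^ 2)⁻¹) * ((c ^ 2)⁻¹) ^ k / (k.factorial : ℝ) - c * stdNormalDensity z| ≤
      c ^ 2 * (6 * (1 + |z|) ^ 3 * Real.exp (1 - |z| ^ 2 / 4)) := by
  set u := c * z with hu
  have hl1 : 1 ≤ (c ^ 2)⁻¹ := (one_le_inv₀ (by positivity)).2 (by nlinarith)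
  have hu' := abs_le.1 hz
  have hkl : (c ^ 2)⁻¹ * (15 / 16) ≤ (k : ℝ) := by
    rw [hk]; gcongr; linarith
  have hk1 : 1 ≤ k := by
    have : (0 : ℝ) < k := by linarith
    exact_mod_cast this
  rw [aux_poisson ((c ^ 2)⁻¹) u k hk1 (by positivity) hk]
  obtain ⟨hs0, hs1⟩ := aux_stirling k hk1
  set S := Real.log (Stirling.stirlingSeq k) - Real.log (√Real.pi) with hS
  have hsq : √(1 / (c ^ 2)⁻¹) = c := by
    rw [one_div, inv_inv, Real.sqrt_sq hc.le]
  rw [hsq]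
  have hSc : S ≤ c / 10 := by
    refine hs1.trans ?_
    rw [div_le_iff₀ (by positivity)]
    have : c / 10 * (12 * ((c ^ 2)⁻¹ * (15 / 16))) ≤ c / 10 * (12 * k) := by gcongr
    refine le_trans ?_ this
    have : c / 10 * (12 * ((c ^ 2)⁻¹ * (15 / 16))) = 9 / 8 * c⁻¹ := by
      field_simp; norm_num
    rw [this]
    have : 1 ≤ c⁻¹ := (one_le_inv₀ hc).2 hc1
    linarith
  have hh := aux_h u hz
  have hlg := aux_log u hz
  set L := Real.log (1 + u) with hL
  set H := (1 + u) * L - u with hH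
  have hz0 := abs_nonneg z
  have hau : |u| = c * |z| := by rw [hu, abs_mul, abs_of_pos hc]
  have hdiff : |(c ^ 2)⁻¹ * (H - u ^ 2 / 2)| ≤ 7 / 2 * (c * |z| ^ 3) := by
    rw [abs_mul, abs_of_pos (by positivity : 0 < (c ^ 2)⁻¹)]
    calc _ ≤ (c ^ 2)⁻¹ * (7 / 2 * |u| ^ 3) := by gcongr
      _ = _ := by rw [hau]; field_simp
  have huz : (c ^ 2)⁻¹ * u ^ 2 = z ^ 2 := by rw [hu]; field_simp
  set a := -((c ^ 2)⁻¹ * H) - 1 / 2 * L - S with ha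
  have hab : a - (-z ^ 2 / 2) = -((c ^ 2)⁻¹ * (H - u ^ 2 / 2)) - 1 / 2 * L - S := by
    rw [ha, mul_sub, ← huz]; ring
  have hd1 := abs_le.1 hdiff
  have hl2 := abs_le.1 hlg
  rw [hau] at hl2 hz
  have habs : |a - (-z ^ 2 / 2)| ≤ c * (6 * (1 + |z|) ^ 3) := by
    have hq : 7 / 2 * |z| ^ 3 + |z| + 1 ≤ 6 * (1 + |z|) ^ 3 := by
      nlinarith [pow_nonneg hz0 2, pow_nonneg hz0 3]
    have hq2 : 7 / 2 * (c * |z| ^ 3) + c * |z| + c ≤ c * (6 * (1 + |z|) ^ 3) := by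
      calc _ = c * (7 / 2 * |z| ^ 3 + |z| + 1) := by ring
        _ ≤ _ := by gcongr
    rw [hab, abs_le]
    constructor <;> linarith [hd1.1, hd1.2, hl2.1, hl2.2]
  have haM : a ≤ 1 - |z| ^ 2 / 4 := by
    have : c * |z| ^ 3 ≤ 1 / 16 * |z| ^ 2 := by
      calc _ = c * |z| * |z| ^ 2 := by ring
        _ ≤ _ := by gcongr
    have h4 := sq_abs z
    nlinarith [hd1.1, hd1.2, hl2.1, hl2.2, hab, sq_nonneg z]
  have hmain := aux_exp a (-z ^ 2 / 2) _ haM (by rw [sq_abs]; nlinarith [sq_nonneg z])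
  have hs := aux_sqrt
  have e : c / √(2 * Real.pi) * Real.exp a - c * stdNormalDensity z =
      c * (Real.exp a - Real.exp (-z ^ 2 / 2)) / √(2 * Real.pi) := by
    unfold stdNormalDensity; ring
  rw [e, abs_div, abs_of_pos (by linarith : 0 < √(2 * Real.pi))]
  refine (div_le_self (abs_nonneg _) hs).trans ?_
  rw [abs_mul, abs_of_pos hc]
  calc _ ≤ c * (c * (6 * (1 + |z|) ^ 3) * Real.exp (1 - |z| ^ 2 / 4)) := by
        gcongr
        exact hmain.trans (by gcongr)
    _ = _ := by ring

/-- Chernoff bound -/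
lemma aux_chernoff (l t : ℝ) (k : ℕ) (hl : 0 < l) (ht : |t| ≤ 1) :
    Real.exp (-l) * l ^ k / (k.factorial : ℝ) ≤ Real.exp (l * t ^ 2 - t * (k - l)) := by
  have h1 := Real.pow_div_factorial_le_exp (l * Real.exp t) (by positivity) k
  have h2 := (abs_le.1 (Real.abs_exp_sub_one_sub_id_le ht)).2
  have h3 : Real.exp t ^ k = Real.exp (k * t) := by rw [← Real.exp_nat_mul]
  rw [mul_pow, h3] at h1
  have e : Real.exp (-l) * l ^ k / (k.factorial : ℝ) =
      Real.exp (-l - k * t) * (l ^ k * Real.exp (k * t) / k.factorial) := by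
    rw [Real.exp_sub]; field_simp
  rw [e]
  calc _ ≤ Real.exp (-l - k * t) * Real.exp (l * Real.exp t) := by gcongr
    _ = Real.exp (-l - k * t + l * Real.exp t) := by rw [Real.exp_add]
    _ ≤ _ := by
      apply Real.exp_le_exp.2
      nlinarith

lemma aux_far (c z : ℝ) (k : ℕ) (hc : 0 < c) (hc1 : c ≤ 1) (hz : 1 / 16 < |c * z|)
    (hk : (k : ℝ) - (c ^ 2)⁻¹ = c⁻¹ * z) :
    Real.exp (-(c ^ 2)⁻¹) * ((c ^ 2)⁻¹) ^ k / (k.factorial : ℝ) ≤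
      c ^ 2 * (6 * 100 ^ 3 * 17 ^ 3) / (1 + |z|) ^ 3 := by
  have hz1 : 1 / 16 < c * |z| := by rwa [abs_mul, abs_of_pos hc] at hz
  have hz0 : 1 / 16 < |z| := by nlinarith [abs_nonneg z]
  have key : Real.exp (-(c ^ 2)⁻¹) * ((c ^ 2)⁻¹) ^ k / (k.factorial : ℝ) ≤
      Real.exp ((c ^ 2)⁻¹ * (1 / 40) ^ 2 - 1 / 40 * (c⁻¹ * |z|)) := by
    rcases le_total 0 z with h | h
    · have := aux_chernoff ((c ^ 2)⁻¹) (1 / 40) k (by positivity) (by norm_num [abs_le])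
      rw [hk] at this
      rwa [abs_of_nonneg h]
    · have := aux_chernoff ((c ^ 2)⁻¹) (-(1 / 40)) k (by positivity) (by norm_num [abs_le])
      rw [hk] at this
      rw [abs_of_nonpos h]
      refine this.trans (le_of_eq ?_)
      ring_nf
  have hlz : (c ^ 2)⁻¹ ≤ 16 * (c⁻¹ * |z|) := by
    have : c⁻¹ * |z| = (c ^ 2)⁻¹ * (c * |z|) := by field_simp
    rw [this]
    have : 0 < (c ^ 2)⁻¹ := by positivity
    nlinarith
  set x := c⁻¹ * |z| / 100 with hx
  have hx0 : 0 < x := by positivity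
  have h2 : Real.exp ((c ^ 2)⁻¹ * (1 / 40) ^ 2 - 1 / 40 * (c⁻¹ * |z|)) ≤ Real.exp (-x) := by
    apply Real.exp_le_exp.2
    rw [hx]; linarith
  have h3 := Real.pow_div_factorial_le_exp x hx0.le 3
  have h4 : Real.exp (-x) ≤ 6 / x ^ 3 := by
    rw [Real.exp_neg, inv_le_comm₀ (Real.exp_pos _) (by positivity)]
    refine le_trans (le_of_eq ?_) h3
    norm_num [Nat.factorial]
  refine (key.trans (h2.trans h4)).trans ?_
  have hx17 : (1 + |z|) / (17 * 100 * c) ≤ x := by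
    rw [hx, div_le_iff₀ (by positivity)]
    have : c⁻¹ * |z| / 100 * (17 * 100 * c) = 17 * |z| := by field_simp
    rw [this]; linarith
  calc _ ≤ 6 / ((1 + |z|) / (17 * 100 * c)) ^ 3 := by gcongr
    _ = c * (c ^ 2 * (6 * 100 ^ 3 * 17 ^ 3) / (1 + |z|) ^ 3) := by field_simp
    _ ≤ 1 * (c ^ 2 * (6 * 100 ^ 3 * 17 ^ 3) / (1 + |z|) ^ 3) := by gcongr
    _ = _ := one_mul _

lemma aux_far_phi (c z : ℝ) (hc : 0 < c) (hz : 1 / 16 < |c * z|) :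
    c * stdNormalDensity z ≤ c ^ 2 * (16 * (1 + |z|) * Real.exp (1 - |z| ^ 2 / 4)) := by
  have hz1 : 1 / 16 < c * |z| := by rwa [abs_mul, abs_of_pos hc] at hz
  have h1 : stdNormalDensity z ≤ Real.exp (1 - |z| ^ 2 / 4) := by
    unfold stdNormalDensity
    refine (div_le_self (Real.exp_pos _).le aux_sqrt).trans (Real.exp_le_exp.2 ?_)
    rw [sq_abs]; nlinarith [sq_nonneg z]
  calc _ ≤ c * Real.exp (1 - |z| ^ 2 / 4) := by gcongr
    _ = c * (1 * Real.exp (1 - |z| ^ 2 / 4)) := by ring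
    _ ≤ c * ((c * (16 * (1 + |z|))) * Real.exp (1 - |z| ^ 2 / 4)) := by
      gcongr; nlinarith
    _ = _ := by ring

lemma aux_point (c z : ℝ) (k : ℤ) (hc : 0 < c) (hc1 : c ≤ 1)
    (hk : (k : ℝ) = (c ^ 2)⁻¹ * (1 + c * z)) :
    |poissonPoint ((c ^ 2)⁻¹) k - c * stdNormalDensity z| ≤
      c ^ 2 * (16 * (1 + |z|) ^ 3 * Real.exp (1 - |z| ^ 2 / 4)) +
      c ^ 2 * (6 * 100 ^ 3 * 17 ^ 3) / (1 + |z|) ^ 3 := by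
  have hphi : 0 ≤ stdNormalDensity z := by unfold stdNormalDensity; positivity
  have hz0 := abs_nonneg z
  have hpos2 : 0 ≤ c ^ 2 * (6 * 100 ^ 3 * 17 ^ 3) / (1 + |z|) ^ 3 := by positivity
  have hlc : (0 : ℝ) < (c ^ 2)⁻¹ := by positivity
  rcases le_or_gt |c * z| (1 / 16) with h | h
  · have hk0 : 0 ≤ k := by
      have : (0 : ℝ) ≤ k := by
        rw [hk]
        have := (abs_le.1 h).1
        apply mul_nonneg hlc.le; linarith
      exact_mod_cast this
    lift k to ℕ using hk0
    have := aux_near c z k hc hc1 h (by exact_mod_cast hk)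
    simp only [poissonPoint, Int.natCast_nonneg, if_true, Int.toNat_natCast]
    have h2 : c ^ 2 * (6 * (1 + |z|) ^ 3 * Real.exp (1 - |z| ^ 2 / 4)) ≤
      c ^ 2 * (16 * (1 + |z|) ^ 3 * Real.exp (1 - |z| ^ 2 / 4)) := by
      gcongr; norm_num
    linarith
  · have h1 := aux_far_phi c z hc h
    have h1' : c ^ 2 * (16 * (1 + |z|) * Real.exp (1 - |z| ^ 2 / 4)) ≤
        c ^ 2 * (16 * (1 + |z|) ^ 3 * Real.exp (1 - |z| ^ 2 / 4)) := by
      gcongr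
      exact le_self_pow₀ (by linarith) (by norm_num)
    have h2 : 0 ≤ poissonPoint ((c ^ 2)⁻¹) k ∧ poissonPoint ((c ^ 2)⁻¹) k ≤
        c ^ 2 * (6 * 100 ^ 3 * 17 ^ 3) / (1 + |z|) ^ 3 := by
      by_cases hk0 : 0 ≤ k
      · lift k to ℕ using hk0
        simp only [poissonPoint, Int.natCast_nonneg, if_true, Int.toNat_natCast]
        refine ⟨by positivity, aux_far c z k hc hc1 h ?_⟩
        have hk' : (k : ℝ) = (c ^ 2)⁻¹ * (1 + c * z) := by exact_mod_cast hk
        rw [hk']; field_simp; ring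
      · simp only [poissonPoint, hk0, if_false]
        exact ⟨le_rfl, hpos2⟩
    have h3 : 0 ≤ c * stdNormalDensity z := by positivity
    rw [abs_le]
    constructor <;> linarith [h2.1, h2.2]

/-- Weighted local central limit estimate for the Poisson law near criticality
(estimate (7.2)): there exist `c₀ > 0` and `C < ∞` such that for every
`c ∈ (0, c₀]` and every `k ∈ ℤ`, with `λ = c^{-2}` and `z_{k,c} = c(k − λ)`,
`|P(Poisson(λ) = k) − ∫_{z−c/2}^{z+c/2} φ(x) dx| ≤ C c² / (1+|z_{k,c}|)³`. -/
theorem poisson_local_clt_cell_bound :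
    ∃ c₀ : ℝ, 0 < c₀ ∧ ∃ C : ℝ, ∀ c ∈ Set.Ioc (0 : ℝ) c₀, ∀ k : ℤ,
      |poissonPoint (c ^ (-2 : ℤ)) k -
          ∫ x in (c * ((k : ℝ) - c ^ (-2 : ℤ)) - c / 2)..(c * ((k : ℝ) - c ^ (-2 : ℤ)) + c / 2),
            stdNormalDensity x| ≤
        C * c ^ 2 / (1 + |c * ((k : ℝ) - c ^ (-2 : ℤ))|) ^ 3 := by
  refine ⟨1, one_pos, 17 * (Real.exp 3 * (Nat.factorial 6 : ℕ)) + 6 * 100 ^ 3 * 17 ^ 3, ?_⟩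
  rintro c ⟨hc, hc1⟩ k
  have e : c ^ (-2 : ℤ) = (c ^ 2)⁻¹ := by
    rw [zpow_neg]; norm_cast
  rw [e]
  set z := c * ((k : ℝ) - (c ^ 2)⁻¹) with hz
  have hk : (k : ℝ) = (c ^ 2)⁻¹ * (1 + c * z) := by
    rw [hz]; field_simp; ring
  have h1 := aux_point c z k hc hc1 hk
  have h2 := aux_cell z c hc hc1
  have hz0 := abs_nonneg z
  have h3 := aux_decay |z| hz0 6
  have h4 : (1 + |z|) ^ 3 * Real.exp (1 - |z| ^ 2 / 4) ≤
      Real.exp 3 * (Nat.factorial 6 : ℕ) / (1 + |z|) ^ 3 := by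
    rw [le_div_iff₀ (by positivity)]
    refine le_trans (le_of_eq ?_) h3
    ring
  have h5 : c ^ 2 * (1 + |z|) * Real.exp (1 - |z| ^ 2 / 4) ≤
      c ^ 2 * (1 + |z|) ^ 3 * Real.exp (1 - |z| ^ 2 / 4) := by
    gcongr
    exact le_self_pow₀ (by linarith) (by norm_num)
  have h6 := abs_sub_le (poissonPoint ((c ^ 2)⁻¹) k) (c * stdNormalDensity z)
    (∫ x in (z - c / 2)..(z + c / 2), stdNormalDensity x)
  rw [abs_sub_comm] at h2
  refine h6.trans ((add_le_add h1 (h2.trans h5)).trans ?_)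
  calc _ = 17 * c ^ 2 * ((1 + |z|) ^ 3 * Real.exp (1 - |z| ^ 2 / 4)) +
        c ^ 2 * (6 * 100 ^ 3 * 17 ^ 3) / (1 + |z|) ^ 3 := by ring
    _ ≤ 17 * c ^ 2 * (Real.exp 3 * (Nat.factorial 6 : ℕ) / (1 + |z|) ^ 3) +
        c ^ 2 * (6 * 100 ^ 3 * 17 ^ 3) / (1 + |z|) ^ 3 := by gcongr
    _ = _ := by ring
end

section
/- Let J_c ~ Poisson(c^{−2}) and set Z_c := c(J_c − c^{−2}). There exist constants c₀ > 0 and C < ∞ such that for every c ∈ (0, c₀]: (1) if U ~ Uniform[−c/2, c/2] is independent of J_c, then TV(law(Z_c + U), N(0,1)) ≤ C·c and TV(law(Z_c + c + U), N(c,1)) ≤ C·c; (2) if ρ_c : ℝ → ℝ is the rounding map sending x in the interval [c(k − c^{−2}) − c/2, c(k − c^{−2}) + c/2) to c(k − c^{−2}), then TV(pushforward of N(0,1) under ρ_c, law(Z_c)) ≤ C·c and TV(pushforward of N(c,1) under ρ_c, law(Z_c + c)) ≤ C·c. -/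
open MeasureTheory ProbabilityTheory

/-- The Poisson distribution on `ℕ` with mean `r ≥ 0`. -/
noncomputable def poissonMeasure (r : ℝ) : Measure ℕ :=
  Measure.sum fun k : ℕ =>
    (ENNReal.ofReal (Real.exp (-r) * r ^ k / (Nat.factorial k))) • Measure.dirac k

/-- The law of `Z_c = c(J_c − c^{−2})` with `J_c ~ Poisson(c^{−2})`. -/
noncomputable def lawZ (c : ℝ) : Measure ℝ :=
  Measure.map (fun k : ℕ => c * ((k : ℝ) - c ^ (-2 : ℤ))) (poissonMeasure (c ^ (-2 : ℤ)))

/-- The uniform distribution on `[−c/2, c/2]`. -/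
noncomputable def unifJitter (c : ℝ) : Measure ℝ :=
  (ENNReal.ofReal c)⁻¹ • volume.restrict (Set.Icc (-(c / 2)) (c / 2))

/-- The law of `Z_c + a + U` with `J_c ~ Poisson(c^{−2})` and an independent
uniform jitter `U ~ Uniform[−c/2, c/2]`. -/
noncomputable def jitteredLaw (c a : ℝ) : Measure ℝ :=
  Measure.map (fun x : ℕ × ℝ => c * ((x.1 : ℝ) - c ^ (-2 : ℤ)) + a + x.2)
    ((poissonMeasure (c ^ (-2 : ℤ))).prod (unifJitter c))

/-- The rounding map `ρ_c`, sending `x ∈ [c(k − c^{−2}) − c/2, c(k − c^{−2}) + c/2)`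
to the lattice point `c(k − c^{−2})`. -/
noncomputable def roundLattice (c : ℝ) (x : ℝ) : ℝ :=
  c * (⌊(x + c⁻¹) / c + 1 / 2⌋ : ℝ) - c⁻¹


lemma log_fact_le (k : ℕ) (hk : 2 ≤ k) :
    Real.log (k.factorial : ℝ) ≤ Real.log (2 * Real.pi) / 2 + Real.log k / 2 + k * Real.log k - k
      + 1 / (4 * ((k : ℝ) - 1)) := by
  have hmono : Monotone (fun n : ℕ => Real.log (Stirling.stirlingSeq (n + 2)) - 1 / (4 * ((n : ℝ) + 1))) := by
    apply monotone_nat_of_le_succ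
    intro n
    have h := Stirling.log_stirlingSeq_sdiff_le (n + 2)
    have h2 : (1 : ℝ) / (12 * ((n + 2 : ℕ) : ℝ) * (((n + 2 : ℕ) : ℝ) + 1)) ≤
        1 / (4 * ((n : ℝ) + 1)) - 1 / (4 * (((n + 1 : ℕ) : ℝ) + 1)) := by
      push_cast
      have hn : (0 : ℝ) ≤ n := Nat.cast_nonneg n
      rw [div_sub_div _ _ (by positivity) (by positivity), div_le_div_iff₀ (by positivity) (by positivity)]
      nlinarith [mul_nonneg hn hn, mul_nonneg hn (mul_nonneg hn hn)]
    push_cast at h h2 ⊢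
    simp only [show n + 1 + 2 = n + 3 by ring] at h ⊢
    linarith
  have hlim : Filter.Tendsto (fun n : ℕ => Real.log (Stirling.stirlingSeq (n + 2)) - 1 / (4 * ((n : ℝ) + 1)))
      Filter.atTop (nhds (Real.log (Real.sqrt Real.pi) - 0)) := by
    apply Filter.Tendsto.sub
    · apply Filter.Tendsto.log _ (by positivity)
      exact (Filter.tendsto_add_atTop_iff_nat 2).2 Stirling.tendsto_stirlingSeq_sqrt_pi
    · have := (tendsto_one_div_add_atTop_nhds_zero_nat (𝕜 := ℝ)).const_mul (1/4)
      simp only [mul_zero] at this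
      refine this.congr fun n => ?_
      field_simp
  have h := hmono.ge_of_tendsto hlim (k - 2)
  obtain ⟨m, rfl⟩ : ∃ m, k = m + 2 := ⟨k - 2, by omega⟩
  simp only [Nat.add_sub_cancel, Stirling.log_stirlingSeq_formula] at h
  have hm : (0 : ℝ) ≤ m := Nat.cast_nonneg m
  rw [Real.log_sqrt (by positivity)] at h
  rw [Real.log_mul (by norm_num) (by positivity), Real.log_div (by positivity) (by positivity), Real.log_exp] at h
  rw [Real.log_mul (by norm_num) (by positivity)]
  have e : ((m + 2 : ℕ) : ℝ) - 1 = m + 1 := by push_cast; ring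
  rw [e]
  linarith

lemma entropy_le (t : ℝ) (ht : |t| ≤ 1 / 8) :
    (1 + t) * Real.log (1 + t) - t ≤ t ^ 2 / 2 + 2 * |t| ^ 3 := by
  have h := Real.abs_log_sub_add_sum_range_le (x := -t) (by rw [abs_neg]; linarith) 2
  simp [Finset.sum_range_succ] at h
  have h3 : |t| ^ 3 / (1 - |t|) ≤ |t| ^ 3 * (8 / 7) := by
    rw [div_le_iff₀ (by linarith)]
    have : 0 ≤ |t| ^ 3 := by positivity
    nlinarith
  have h1 := (abs_le.1 h).2
  have hb := abs_le.1 ht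
  have hl : Real.log (1 + t) ≤ t - t ^ 2 / 2 + |t| ^ 3 * (8 / 7) := by norm_num at h1; linarith
  have := mul_le_mul_of_nonneg_left hl (by linarith : 0 ≤ 1 + t)
  have h4 : - t ^ 3 ≤ |t| ^ 3 := by rw [← abs_pow]; exact neg_le_abs _
  have h5 : t * |t| ^ 3 ≤ |t| ^ 3 / 8 := by
    have : 0 ≤ |t| ^ 3 := by positivity
    nlinarith
  have h6 : 0 ≤ |t| ^ 3 := by positivity
  nlinarith

set_option maxHeartbeats 1000000 in
lemma density_le (c x : ℝ) (k : ℕ) (hc : 0 < c) (hxy : |x - (c * k - c⁻¹)| ≤ c / 2)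
    (hs : c * (1 + |x|) ≤ 1 / 8) :
    gaussianPDFReal 0 1 x * (1 - 8 * c * (1 + |x|) ^ 3) ≤
      c⁻¹ * (Real.exp (-(c ^ (-2 : ℤ))) * (c ^ (-2 : ℤ)) ^ k / (Nat.factorial k)) := by
  obtain ⟨y, hy⟩ : ∃ y, y = c * k - c⁻¹ := ⟨_, rfl⟩
  rw [← hy] at hxy
  obtain ⟨lam, hlam⟩ : ∃ l : ℝ, l = c ^ (-2 : ℤ) := ⟨_, rfl⟩
  rw [← hlam]
  have hlc : lam * c ^ 2 = 1 := by rw [hlam, zpow_neg]; field_simp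
  have hlpos : 0 < lam := by rw [hlam]; positivity
  have hx0 := abs_nonneg x
  have hc8 : c ≤ 1 / 8 := by nlinarith
  have hc2 : c ^ 2 ≤ 1 / 64 := by nlinarith
  have hlam64 : 64 ≤ lam := by nlinarith [mul_le_mul_of_nonneg_left hc2 hlpos.le]
  have hyx : |y| ≤ |x| + c / 2 := by
    have := abs_sub_abs_le_abs_sub y x
    rw [abs_sub_comm] at this; linarith
  set t := c * y with htdef
  have htabs : |t| = c * |y| := by rw [htdef, abs_mul, abs_of_pos hc]
  have ht : |t| ≤ 1 / 8 := by
    rw [htabs]; nlinarith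
  have htb := abs_le.1 ht
  have hks : (k : ℝ) = lam * (1 + t) := by
    have : 1 + t = c ^ 2 * k := by rw [htdef, hy]; field_simp; ring
    rw [this, ← mul_assoc, hlc, one_mul]
  have hk56 : (56 : ℝ) ≤ k := by rw [hks]; nlinarith
  have hk2 : 2 ≤ k := by
    have : (2 : ℝ) ≤ k := by linarith
    exact_mod_cast this
  have hfact := log_fact_le k hk2
  have hent := entropy_le t ht
  have hlogk : Real.log k = Real.log lam + Real.log (1 + t) := by
    rw [hks, Real.log_mul (by positivity) (by linarith)]
  have hloglam : Real.log lam = - 2 * Real.log c := by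
    rw [hlam, Real.log_zpow]; norm_num
  have hlog1 : Real.log (1 + t) ≤ |t| := by
    have := Real.log_le_sub_one_of_pos (show 0 < 1 + t by linarith)
    linarith [le_abs_self t]
  have hrem : 1 / (4 * ((k : ℝ) - 1)) ≤ c := by
    rw [div_le_iff₀ (by linarith)]
    have : lam / 4 ≤ k - 1 := by rw [hks]; nlinarith
    have : c * (lam / 4) ≤ c * (k - 1) := mul_le_mul_of_nonneg_left this hc.le
    have : 1 ≤ c * lam := by nlinarith [mul_pos hc hlpos]
    linarith
  set w := 1 + |x| with hw
  have hw1 : 1 ≤ w := by linarith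
  have hyw : |y| ≤ w := by linarith
  have hy3 : |y| ^ 3 ≤ w ^ 3 := pow_le_pow_left₀ (abs_nonneg _) hyw 3
  have hw3 : w ≤ w ^ 3 := le_self_pow₀ hw1 (by norm_num)
  have hlt2 : lam * t ^ 2 = y ^ 2 := by rw [htdef, mul_pow, ← mul_assoc, hlc, one_mul]
  have hlt3 : lam * |t| ^ 3 = c * |y| ^ 3 := by
    rw [htabs]
    calc lam * (c * |y|) ^ 3 = (lam * c ^ 2) * (c * |y| ^ 3) := by ring
      _ = _ := by rw [hlc, one_mul]
  have hent2 := mul_le_mul_of_nonneg_left hent hlpos.le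
  have hyx2 : y ^ 2 / 2 ≤ x ^ 2 / 2 + c * w := by
    have h1 : y ^ 2 - x ^ 2 ≤ |x - y| * (|x| + |y|) := by
      calc y ^ 2 - x ^ 2 ≤ |y ^ 2 - x ^ 2| := le_abs_self _
        _ = |x - y| * |x + y| := by rw [← abs_mul, ← abs_neg]; congr 1; ring
        _ ≤ _ := by gcongr; exact abs_add_le x y
    have h2 : |x - y| * (|x| + |y|) ≤ c / 2 * (w + w) := by gcongr; linarith
    have h3 : 0 ≤ c * w := by positivity
    linarith
  have hlogR : Real.log (c⁻¹ * (Real.exp (-lam) * lam ^ k / (Nat.factorial k))) =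
      - Real.log c - lam + k * Real.log lam - Real.log (k.factorial) := by
    have : (0 : ℝ) < k.factorial := by positivity
    rw [Real.log_mul (by positivity) (by positivity), Real.log_div (by positivity) (by positivity),
      Real.log_mul (by positivity) (by positivity), Real.log_exp, Real.log_pow, Real.log_inv]
    ring
  have hkey : - Real.log (2 * Real.pi) / 2 - x ^ 2 / 2 - 8 * c * w ^ 3 ≤
      Real.log (c⁻¹ * (Real.exp (-lam) * lam ^ k / (Nat.factorial k))) := by
    rw [hlogR]
    have e1 : lam * ((1 + t) * Real.log (1 + t) - t) = k * Real.log (1 + t) - k + lam := by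
      rw [hks]; ring
    rw [e1] at hent2
    have e2 : lam * (t ^ 2 / 2 + 2 * |t| ^ 3) = y ^ 2 / 2 + 2 * (c * |y| ^ 3) := by
      rw [← hlt3, ← hlt2]; ring
    rw [e2] at hent2
    rw [hlogk] at hfact
    have b1 : c * |y| ^ 3 ≤ c * w ^ 3 := by gcongr
    have b2 : c * w ≤ c * w ^ 3 := by gcongr
    have b3 : c * |y| ≤ c * w ^ 3 := by gcongr; linarith
    have b4 : c ≤ c * w ^ 3 := le_mul_of_one_le_right hc.le (hw1.trans hw3)
    have e3 : (k : ℝ) * (Real.log lam + Real.log (1 + t)) = k * Real.log lam + k * Real.log (1 + t) := by ring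
    rw [e3] at hfact
    have b5 : 0 ≤ c * |y| := by positivity
    linarith
  have hpos : 0 < c⁻¹ * (Real.exp (-lam) * lam ^ k / (Nat.factorial k)) := by positivity
  have := (Real.le_log_iff_exp_le hpos).1 hkey
  refine le_trans ?_ this
  have hg : gaussianPDFReal 0 1 x = Real.exp (- Real.log (2 * Real.pi) / 2 - x ^ 2 / 2) := by
    rw [gaussianPDFReal, sub_eq_add_neg (- Real.log (2 * Real.pi) / 2), Real.exp_add]
    have : Real.exp (- Real.log (2 * Real.pi) / 2) = (Real.sqrt (2 * Real.pi))⁻¹ := by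
      rw [neg_div, Real.exp_neg, ← Real.log_sqrt (by positivity), Real.exp_log (by positivity)]
    rw [this]
    simp [neg_div]
  rw [hg, sub_eq_add_neg (- Real.log (2 * Real.pi) / 2 - x ^ 2 / 2) (8 * c * w ^ 3), Real.exp_add]
  gcongr
  linarith [Real.add_one_le_exp (-(8 * c * w ^ 3))]

lemma poisson_prob (r : ℝ) (hr : 0 ≤ r) : IsProbabilityMeasure (_root_.poissonMeasure r) := by
  constructor
  rw [_root_.poissonMeasure, Measure.sum_apply _ MeasurableSet.univ]
  simp only [Measure.smul_apply, measure_univ, smul_eq_mul, mul_one]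
  have hsum : HasSum (fun k : ℕ => Real.exp (-r) * r ^ k / (Nat.factorial k)) 1 := by
    have := (NormedSpace.expSeries_div_hasSum_exp (𝔸 := ℝ) r).mul_left (Real.exp (-r))
    rw [← Real.exp_eq_exp_ℝ, ← Real.exp_add] at this
    simpa [mul_div_assoc] using this
  rw [← ENNReal.ofReal_tsum_of_nonneg (fun k => by positivity) hsum.summable, hsum.tsum_eq]
  simp

lemma unif_prob (c : ℝ) (hc : 0 < c) : IsProbabilityMeasure (unifJitter c) := by
  constructor
  rw [unifJitter, Measure.smul_apply, Measure.restrict_apply MeasurableSet.univ, Set.univ_inter,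
    Real.volume_Icc, smul_eq_mul]
  have : c / 2 - -(c / 2) = c := by ring
  rw [this]
  exact ENNReal.inv_mul_cancel (by simpa using hc) ENNReal.ofReal_ne_top

lemma meas_jit (c a : ℝ) : Measurable (fun x : ℕ × ℝ => c * ((x.1 : ℝ) - c ^ (-2 : ℤ)) + a + x.2) := by
  fun_prop

lemma jit_apply (c : ℝ) (hc : 0 < c) (A : Set ℝ) (hA : MeasurableSet A) :
    jitteredLaw c 0 A = ∑' k : ℕ,
      ENNReal.ofReal (Real.exp (-(c ^ (-2 : ℤ))) * (c ^ (-2 : ℤ)) ^ k / (Nat.factorial k)) *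
        ((ENNReal.ofReal c)⁻¹ * volume (A ∩ Set.Icc (c * k - c⁻¹ - c / 2) (c * k - c⁻¹ + c / 2))) := by
  have := unif_prob c hc
  rw [jitteredLaw, Measure.map_apply (meas_jit c 0) hA, Measure.prod_apply (meas_jit c 0 hA),
    _root_.poissonMeasure, lintegral_sum_measure]
  congr 1
  ext k
  rw [lintegral_smul_measure, lintegral_dirac, unifJitter, Measure.smul_apply, smul_eq_mul, smul_eq_mul]
  congr 2
  have hm : MeasurableSet (Prod.mk k ⁻¹' ((fun x : ℕ × ℝ => c * ((x.1 : ℝ) - c ^ (-2 : ℤ)) + 0 + x.2) ⁻¹' A)) :=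
    measurable_prodMk_left (meas_jit c 0 hA)
  rw [Measure.restrict_apply hm, ← measure_preimage_add volume (c * k - c⁻¹)
    (A ∩ Set.Icc (c * k - c⁻¹ - c / 2) (c * k - c⁻¹ + c / 2))]
  congr 1
  have e : c * ((k : ℝ) - c ^ (-2 : ℤ)) = c * k - c⁻¹ := by
    rw [zpow_neg]; field_simp
  ext u
  simp only [Set.mem_inter_iff, Set.mem_preimage, Set.mem_Icc, e, add_zero]
  constructor
  · rintro ⟨h1, h2, h3⟩
    exact ⟨h1, by linarith, by linarith⟩
  · rintro ⟨h1, h2, h3⟩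
    exact ⟨h1, by linarith, by linarith⟩

lemma lower_bound (c : ℝ) (hc : 0 < c) (A : Set ℝ) (hA : MeasurableSet A) :
    ∫⁻ x in A, ENNReal.ofReal (gaussianPDFReal 0 1 x * (1 - 8 * c * (1 + |x|) ^ 3)) ≤
      jitteredLaw c 0 A := by
  set g : ℝ → ENNReal := fun x => ENNReal.ofReal (gaussianPDFReal 0 1 x * (1 - 8 * c * (1 + |x|) ^ 3)) with hg
  set I : ℕ → Set ℝ := fun k => Set.Icc (c * k - c⁻¹ - c / 2) (c * k - c⁻¹ + c / 2) with hI
  -- g vanishes unless c (1 + |x|) ≤ 1/8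
  have hg0 : ∀ x, ¬ (c * (1 + |x|) ≤ 1 / 8) → g x = 0 := by
    intro x hx
    apply ENNReal.ofReal_of_nonpos
    apply mul_nonpos_of_nonneg_of_nonpos (gaussianPDFReal_nonneg _ _ _)
    have h1 : 1 + |x| ≤ (1 + |x|) ^ 3 := le_self_pow₀ (by linarith [abs_nonneg x]) (by norm_num)
    have := mul_le_mul_of_nonneg_left h1 hc.le
    push Not at hx
    linarith
  have hcover : ∀ x, x ∉ ⋃ k, I k → g x = 0 := by
    intro x hx
    apply hg0
    intro hs
    apply hx
    have hci : 8 ≤ c⁻¹ - 0 ∧ |x| ≤ c⁻¹ := by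
      have hcc : c * c⁻¹ = 1 := mul_inv_cancel₀ hc.ne'
      have hx0 := abs_nonneg x
      constructor
      · have : c ≤ 1 / 8 := by nlinarith
        have hp : 0 < c⁻¹ := by positivity
        nlinarith
      · by_contra hcon
        push Not at hcon
        nlinarith
    have hpos : 0 ≤ (x + c⁻¹) / c + 1 / 2 := by
      have : 0 ≤ (x + c⁻¹) / c := div_nonneg (by linarith [neg_abs_le x]) hc.le
      linarith
    refine Set.mem_iUnion.2 ⟨⌊(x + c⁻¹) / c + 1 / 2⌋₊, ?_⟩
    have h1 := Nat.floor_le hpos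
    have h2 := Nat.lt_floor_add_one ((x + c⁻¹) / c + 1 / 2)
    set n := ⌊(x + c⁻¹) / c + 1 / 2⌋₊
    have e : c * ((x + c⁻¹) / c) = x + c⁻¹ := by field_simp
    have h1' := mul_le_mul_of_nonneg_left h1 hc.le
    have h2' := mul_lt_mul_of_pos_left h2 hc
    constructor <;> nlinarith
  calc ∫⁻ x in A, g x ≤ ∫⁻ x in ⋃ k, (A ∩ I k), g x := by
        rw [← Set.inter_iUnion, ← lintegral_indicator hA, ← lintegral_indicator (hA.inter (MeasurableSet.iUnion fun k => measurableSet_Icc))]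
        apply lintegral_mono
        intro x
        by_cases hx : x ∈ ⋃ k, I k
        · by_cases hxA : x ∈ A
          · rw [Set.indicator_of_mem hxA, Set.indicator_of_mem (show x ∈ A ∩ ⋃ k, I k from ⟨hxA, hx⟩)]
          · rw [Set.indicator_of_notMem hxA]; exact zero_le
        · have : A.indicator g x = 0 := by
            by_cases hxA : x ∈ A
            · rw [Set.indicator_of_mem hxA, hcover x hx]
            · rw [Set.indicator_of_notMem hxA]
          rw [this]; exact zero_le
    _ ≤ ∑' k, ∫⁻ x in A ∩ I k, g x := lintegral_iUnion_le _ _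
    _ ≤ _ := by
        rw [jit_apply c hc A hA]
        apply ENNReal.tsum_le_tsum
        intro k
        rw [← mul_assoc, ← ENNReal.ofReal_inv_of_pos hc, ← ENNReal.ofReal_mul (by positivity),
          ← setLIntegral_const]
        apply setLIntegral_mono measurable_const
        intro x hx
        by_cases hs : c * (1 + |x|) ≤ 1 / 8
        · rw [mul_comm _ c⁻¹]
          apply ENNReal.ofReal_le_ofReal
          apply density_le c x k hc _ hs
          have := hx.2
          rw [abs_le]
          constructor <;> linarith [this.1, this.2]
        · rw [hg0 x hs]; exact zero_le

lemma cube_int : Integrable (fun x : ℝ => (1 + |x|) ^ 3) (gaussianReal 0 1) := by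
  have h : MemLp (fun x : ℝ => 1 + |x|) 3 (gaussianReal 0 1) := by
    have h1 : MemLp (fun _ : ℝ => (1 : ℝ)) 3 (gaussianReal 0 1) := memLp_const 1
    have h2 : MemLp (fun x : ℝ => |x|) 3 (gaussianReal 0 1) :=
      (memLp_id_gaussianReal' (μ := 0) (v := 1) 3 (by simp)).norm
    exact h1.add h2
  have := h.integrable_norm_pow (p := 3) (by norm_num)
  refine this.congr (Filter.Eventually.of_forall fun x => ?_)
  simp only [Real.norm_eq_abs]
  rw [abs_of_nonneg (by positivity)]

lemma main_bound : ∃ C : ℝ, ∀ c : ℝ, 0 < c → ∀ A : Set ℝ, MeasurableSet A →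
    (gaussianReal 0 1 A).toReal - (jitteredLaw c 0 A).toReal ≤ C * c := by
  refine ⟨8 * ∫ x, (1 + |x|) ^ 3 ∂(gaussianReal 0 1), fun c hc A hA => ?_⟩
  have hp1 := unif_prob c hc
  have hp2 := poisson_prob (c ^ (-2 : ℤ)) (by positivity)
  have hp : IsProbabilityMeasure (jitteredLaw c 0) :=
    Measure.isProbabilityMeasure_map (meas_jit c 0).aemeasurable
  have hK : 0 ≤ ∫ x, (1 + |x|) ^ 3 ∂(gaussianReal 0 1) := integral_nonneg fun x => by positivity
  have h1 : gaussianReal 0 1 A ≤ jitteredLaw c 0 A +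
      ENNReal.ofReal (8 * (∫ x, (1 + |x|) ^ 3 ∂(gaussianReal 0 1)) * c) := by
    have hm : Measurable fun x : ℝ => gaussianPDFReal 0 1 x * (8 * c * (1 + |x|) ^ 3) :=
      (measurable_gaussianPDFReal 0 1).mul (by fun_prop)
    calc gaussianReal 0 1 A = ∫⁻ x in A, gaussianPDF 0 1 x := gaussianReal_apply 0 one_ne_zero A
      _ ≤ ∫⁻ x in A, (ENNReal.ofReal (gaussianPDFReal 0 1 x * (1 - 8 * c * (1 + |x|) ^ 3)) +
          ENNReal.ofReal (gaussianPDFReal 0 1 x * (8 * c * (1 + |x|) ^ 3))) := by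
          apply lintegral_mono
          intro x
          refine le_trans ?_ ENNReal.ofReal_add_le
          apply ENNReal.ofReal_le_ofReal
          apply le_of_eq; ring
      _ = (∫⁻ x in A, ENNReal.ofReal (gaussianPDFReal 0 1 x * (1 - 8 * c * (1 + |x|) ^ 3))) +
          ∫⁻ x in A, ENNReal.ofReal (gaussianPDFReal 0 1 x * (8 * c * (1 + |x|) ^ 3)) :=
          lintegral_add_right _ hm.ennreal_ofReal
      _ ≤ _ := by
          gcongr
          · exact lower_bound c hc A hA
          · refine (setLIntegral_le_lintegral _ _).trans (le_of_eq ?_)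
            have : 8 * (∫ x, (1 + |x|) ^ 3 ∂(gaussianReal 0 1)) * c =
                ∫ x, 8 * c * (1 + |x|) ^ 3 ∂(gaussianReal 0 1) := by
              rw [integral_const_mul]; ring
            rw [this, ofReal_integral_eq_lintegral_ofReal (cube_int.const_mul _)
              (Filter.Eventually.of_forall fun x => by positivity),
              gaussianReal_of_var_ne_zero _ one_ne_zero,
              lintegral_withDensity_eq_lintegral_mul _ (measurable_gaussianPDF 0 1) (by fun_prop)]
            congr 1
            ext x
            rw [Pi.mul_apply, gaussianPDF, ENNReal.ofReal_mul (gaussianPDFReal_nonneg _ _ _)]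
  have h2 := ENNReal.toReal_mono (by finiteness) h1
  rw [ENNReal.toReal_add (by finiteness) (by finiteness), ENNReal.toReal_ofReal (by positivity)] at h2
  linarith

lemma main_abs : ∃ C : ℝ, ∀ c : ℝ, 0 < c → ∀ A : Set ℝ, MeasurableSet A →
    |(jitteredLaw c 0 A).toReal - (gaussianReal 0 1 A).toReal| ≤ C * c := by
  obtain ⟨C, hC⟩ := main_bound
  refine ⟨C, fun c hc A hA => ?_⟩
  have hp1 := unif_prob c hc
  have hp2 := poisson_prob (c ^ (-2 : ℤ)) (by positivity)
  have hp : IsProbabilityMeasure (jitteredLaw c 0) :=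
    Measure.isProbabilityMeasure_map (meas_jit c 0).aemeasurable
  have h1 := hC c hc A hA
  have h2 := hC c hc Aᶜ hA.compl
  have e1 := probReal_compl_eq_one_sub (μ := jitteredLaw c 0) hA
  have e2 := probReal_compl_eq_one_sub (μ := gaussianReal 0 1) hA
  simp only [Measure.real] at e1 e2
  rw [e1, e2] at h2
  rw [abs_le]
  constructor <;> linarith

lemma tv_map_le (μ ν : Measure ℝ) (f : ℝ → ℝ) (hf : Measurable f) (B : ℝ)
    (h : ∀ A : Set ℝ, MeasurableSet A → |(μ A).toReal - (ν A).toReal| ≤ B) :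
    tvDist (μ.map f) (ν.map f) ≤ B := by
  have : Nonempty {A : Set ℝ // MeasurableSet A} := ⟨⟨∅, MeasurableSet.empty⟩⟩
  apply ciSup_le
  rintro ⟨A, hA⟩
  rw [Measure.map_apply hf hA, Measure.map_apply hf hA]
  exact h _ (hf hA)

lemma jit_shift (c : ℝ) : jitteredLaw c c = (jitteredLaw c 0).map (fun x => x + c) := by
  rw [jitteredLaw, jitteredLaw, Measure.map_map (by fun_prop) (meas_jit c 0)]
  congr 1
  ext x
  simp only [Function.comp_apply]
  ring

lemma meas_round (c : ℝ) : Measurable (roundLattice c) := by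
  unfold roundLattice
  have : Measurable fun x : ℝ => ((⌊(x + c⁻¹) / c + 1 / 2⌋ : ℤ) : ℝ) :=
    (measurable_from_top (f := fun n : ℤ => (n : ℝ))).comp (Int.measurable_floor.comp (by fun_prop))
  fun_prop

lemma round_jit (c : ℝ) (hc : 0 < c) : (jitteredLaw c 0).map (roundLattice c) = lawZ c := by
  have hp1 := unif_prob c hc
  have hp2 := poisson_prob (c ^ (-2 : ℤ)) (by positivity)
  have hfst : _root_.poissonMeasure (c ^ (-2 : ℤ)) =
      ((_root_.poissonMeasure (c ^ (-2 : ℤ))).prod (unifJitter c)).map Prod.fst := by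
    rw [Measure.map_fst_prod]; simp
  rw [jitteredLaw, Measure.map_map (meas_round c) (meas_jit c 0), lawZ]
  conv_rhs => rw [hfst]
  rw [Measure.map_map (by fun_prop) measurable_fst]
  apply Measure.map_congr
  have hae : ∀ᵐ u ∂(unifJitter c), -(c / 2) ≤ u ∧ u < c / 2 := by
    unfold unifJitter
    apply Measure.ae_smul_measure
    rw [← Measure.restrict_congr_set Ico_ae_eq_Icc]
    filter_upwards [ae_restrict_mem measurableSet_Ico] with u hu using hu
  have hae2 := (Measure.quasiMeasurePreserving_snd (μ := _root_.poissonMeasure (c ^ (-2 : ℤ)))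
    (ν := unifJitter c)).ae hae
  filter_upwards [hae2] with x hx
  simp only [Function.comp_apply, roundLattice]
  have e : c * ((x.1 : ℝ) - c ^ (-2 : ℤ)) = c * x.1 - c⁻¹ := by
    rw [zpow_neg]; field_simp
  rw [e]
  have hfl : ⌊(c * (x.1 : ℝ) - c⁻¹ + 0 + x.2 + c⁻¹) / c + 1 / 2⌋ = (x.1 : ℤ) := by
    have e2 : (c * (x.1 : ℝ) - c⁻¹ + 0 + x.2 + c⁻¹) / c = x.1 + x.2 / c := by field_simp; ring
    rw [e2, Int.floor_eq_iff]
    have h1 : -(1 / 2) ≤ x.2 / c := by rw [le_div_iff₀ hc]; linarith [hx.1]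
    have h2 : x.2 / c < 1 / 2 := by rw [div_lt_iff₀ hc]; linarith [hx.2]
    push_cast
    constructor <;> linarith
  rw [hfl]
  simp

lemma round_shift (c : ℝ) (hc : 0 < c) (x : ℝ) : roundLattice c (x + c) = roundLattice c x + c := by
  unfold roundLattice
  have : (x + c + c⁻¹) / c + 1 / 2 = ((x + c⁻¹) / c + 1 / 2) + 1 := by field_simp; ring
  rw [this, Int.floor_add_one]
  push_cast
  ring

/-- Boundary Berry–Esseen for the Poisson-shift experiment (Theorem 8.1): there are
`c₀ > 0`, `C < ∞` such that for `0 < c ≤ c₀`, (1) the uniformly jittered laws of `Z_c`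
and `Z_c + c` are within `C·c` of `N(0,1)` and `N(c,1)` in total variation, and (2) the
roundings of `N(0,1)` and `N(c,1)` are within `C·c` of the laws of `Z_c` and `Z_c + c`. -/
theorem boundary_berry_esseen_poisson :
    ∃ c₀ : ℝ, 0 < c₀ ∧ ∃ C : ℝ, ∀ c ∈ Set.Ioc (0 : ℝ) c₀,
      (tvDist (jitteredLaw c 0) (gaussianReal 0 1) ≤ C * c ∧
        tvDist (jitteredLaw c c) (gaussianReal c 1) ≤ C * c) ∧
      (tvDist (Measure.map (roundLattice c) (gaussianReal 0 1)) (lawZ c) ≤ C * c ∧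
        tvDist (Measure.map (roundLattice c) (gaussianReal c 1))
          (Measure.map (fun z => z + c) (lawZ c)) ≤ C * c) := by
  obtain ⟨C, hC⟩ := main_abs
  refine ⟨1, one_pos, C, fun c hc => ?_⟩
  have hc0 := hc.1
  have h := hC c hc0
  have h' : ∀ A : Set ℝ, MeasurableSet A →
      |(gaussianReal 0 1 A).toReal - (jitteredLaw c 0 A).toReal| ≤ C * c := fun A hA => by
    rw [abs_sub_comm]; exact h A hA
  have hgs : gaussianReal c 1 = (gaussianReal 0 1).map (fun x => x + c) := by
    rw [gaussianReal_map_add_const, zero_add]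
  have hadd : Measurable (fun x : ℝ => x + c) := by fun_prop
  refine ⟨⟨?_, ?_⟩, ?_, ?_⟩
  · have := tv_map_le _ _ id measurable_id _ h
    rwa [Measure.map_id, Measure.map_id] at this
  · rw [jit_shift, hgs]
    exact tv_map_le _ _ _ hadd _ h
  · rw [← round_jit c hc0]
    exact tv_map_le _ _ _ (meas_round c) _ h'
  · rw [← round_jit c hc0, hgs, Measure.map_map (meas_round c) hadd,
      Measure.map_map hadd (meas_round c)]
    have : roundLattice c ∘ (fun x => x + c) = (fun z => z + c) ∘ roundLattice c :=
      funext fun x => round_shift c hc0 x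
    rw [this]
    exact tv_map_le _ _ _ (hadd.comp (meas_round c)) _ h'
end
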